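/- Upper bound on the marginals of the conditioned tensorized data (Lemma 12.3). Let d ≥ 2, ℓ > 0, N ∈ ℕ, and let ε > 0 satisfy the Boltzmann–Grad scaling N ε^{d−1} = ℓ^{−1}. Let f_0 be a probability density on ℝ^d × ℝ^d with M := ‖f_0‖_{L^∞_x L^1_v} < ∞, and assume ℓ^{−1} |B_1^d| M ε < 1. Then for every 1 ≤ s ≤ N and (almost) every Z_s ∈ ℝ^{2ds}: f_N^{(s)}(0,Z_s) ≤ 1_{Z_s ∈ D_s} · ∏_{i=1}^s f_0(x_i,v_i) · ( 1 − ℓ^{−1} |B_1^d| M ε )^{−s}, where |B_1^d| is the Lebesgue measure of the unit ball in ℝ^d. -/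

import Mathlib

noncomputable section
open MeasureTheory
open scoped BigOperators

/-- Euclidean space `ℝ^d`. -/
abbrev Rd (d : ℕ) := EuclideanSpace ℝ (Fin d)

/-- The `s`-particle hard-sphere phase space `D_s`: all pairwise distances exceed `ε`. -/
def Dset (d s : ℕ) (ε : ℝ) : Set (Fin s → Rd d × Rd d) :=
  {Z | ∀ i j : Fin s, i < j → ε < dist (Z i).1 (Z j).1}

/-- The partition function `𝒵_s = ∫ 1_{Z_s ∈ D_s} ∏ f₀(z_i) dZ_s`. -/
def partitionFunction (d s : ℕ) (ε : ℝ) (f₀ : Rd d × Rd d → ℝ) : ℝ :=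
  ∫ Z in Dset d s ε, ∏ i, f₀ (Z i)

/-- The volume of the unit ball in `ℝ^d`. -/
def unitBallVol (d : ℕ) : ℝ := (volume (Metric.ball (0 : Rd d) 1)).toReal

/-- The conditioned tensorized `N`-particle density
`f_N(0,Z_N) = 𝒵_N⁻¹ 1_{Z_N ∈ D_N} ∏ f₀(z_i)`. -/
def conditionedData (d N : ℕ) (ε : ℝ) (f₀ : Rd d × Rd d → ℝ)
    (Z : Fin N → Rd d × Rd d) : ℝ :=
  (partitionFunction d N ε f₀)⁻¹ *
    Set.indicator (Dset d N ε) (fun W => ∏ i, f₀ (W i)) Z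

/-- The `s`-particle marginal of an `N`-particle function. -/
def marginal (d N s : ℕ) (hsN : s ≤ N) (F : (Fin N → Rd d × Rd d) → ℝ)
    (Z : Fin s → Rd d × Rd d) : ℝ :=
  ∫ W : Fin (N - s) → Rd d × Rd d,
    F (Fin.append Z W ∘ Fin.cast (Nat.add_sub_cancel' hsN).symm)

section

variable {d : ℕ} {ε : ℝ} {f₀ : Rd d × Rd d → ℝ}

lemma measurableSet_Dset (d s : ℕ) (ε : ℝ) : MeasurableSet (Dset d s ε) := by
  have h : Dset d s ε = ⋂ i : Fin s, ⋂ j : Fin s, ⋂ _ : i < j,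
      {Z : Fin s → Rd d × Rd d | ε < dist (Z i).1 (Z j).1} := by
    ext Z
    simp [Dset]
  rw [h]
  refine MeasurableSet.iInter fun i => MeasurableSet.iInter fun j => MeasurableSet.iInter fun _ => ?_
  exact measurableSet_lt measurable_const (by fun_prop)

/-- The unnormalised conditioned tensor product `1_{D_s} ∏ f₀(z_i)`. -/
def conditionedProduct (d s : ℕ) (ε : ℝ) (f₀ : Rd d × Rd d → ℝ) :
    (Fin s → Rd d × Rd d) → ℝ :=
  Set.indicator (Dset d s ε) fun W => ∏ i, f₀ (W i)

lemma conditionedProduct_nonneg (hnn : ∀ z, 0 ≤ f₀ z) {s : ℕ} (Z : Fin s → Rd d × Rd d) :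
    0 ≤ conditionedProduct d s ε f₀ Z :=
  Set.indicator_nonneg (fun _ _ => Finset.prod_nonneg fun _ _ => hnn _) Z

lemma integrable_conditionedProduct (hint : Integrable f₀) (s : ℕ) :
    Integrable (conditionedProduct d s ε f₀) :=
  (Integrable.fintype_prod (f := fun _ : Fin s => f₀) fun _ => hint).indicator
    (measurableSet_Dset d s ε)

lemma integral_conditionedProduct (d s : ℕ) (ε : ℝ) (f₀ : Rd d × Rd d → ℝ) :
    ∫ Z, conditionedProduct d s ε f₀ Z = partitionFunction d s ε f₀ :=
  integral_indicator (measurableSet_Dset d s ε)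

lemma partitionFunction_zero (d : ℕ) (ε : ℝ) (f₀ : Rd d × Rd d → ℝ) :
    partitionFunction d 0 ε f₀ = 1 := by
  have h : Dset d 0 ε = Set.univ := by
    ext Z
    simp [Dset]
  simp [partitionFunction, h, measureReal_def, volume_pi]

lemma partitionFunction_nonneg (hnn : ∀ z, 0 ≤ f₀ z) (s : ℕ) :
    0 ≤ partitionFunction d s ε f₀ := by
  rw [← integral_conditionedProduct]
  exact integral_nonneg (conditionedProduct_nonneg hnn)

/-- Dropping the exclusion between two groups of particles factorises the conditioned product. -/
lemma conditionedProduct_append_le (hnn : ∀ z, 0 ≤ f₀ z) {N s m : ℕ} (h : N = s + m)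
    (Z : Fin s → Rd d × Rd d) (W : Fin m → Rd d × Rd d) :
    conditionedProduct d N ε f₀ (Fin.append Z W ∘ Fin.cast h)
      ≤ conditionedProduct d s ε f₀ Z * conditionedProduct d m ε f₀ W := by
  subst h
  by_cases hD : Fin.append Z W ∘ Fin.cast rfl ∈ Dset d (s + m) ε
  · have hZ : Z ∈ Dset d s ε := fun i j hij => by
      simpa using hD (Fin.castAdd m i) (Fin.castAdd m j) hij
    have hW : W ∈ Dset d m ε := fun i j hij => by
      simpa using hD (Fin.natAdd s i) (Fin.natAdd s j) (by simpa using hij)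
    simp only [conditionedProduct, Set.indicator_of_mem hD, Set.indicator_of_mem hZ,
      Set.indicator_of_mem hW]
    simp [Fin.prod_univ_add]
  · rw [conditionedProduct, Set.indicator_of_notMem hD]
    exact mul_nonneg (conditionedProduct_nonneg hnn Z) (conditionedProduct_nonneg hnn W)

/-- The mass of `f₀` above a ball of radius `ε` in position space. -/
lemma setIntegral_dist_le (hε : 0 < ε) (hint : Integrable f₀) {M : ℝ}
    (hM : ∀ᵐ x : Rd d, (∫ v : Rd d, f₀ (x, v)) ≤ M) (y : Rd d) :
    ∫ z in {z : Rd d × Rd d | dist z.1 y ≤ ε}, f₀ z ≤ ε ^ d * unitBallVol d * M := by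
  have hset : {z : Rd d × Rd d | dist z.1 y ≤ ε} = Metric.closedBall y ε ×ˢ Set.univ := by
    ext z
    simp
  have hint' : Integrable f₀ ((volume : Measure (Rd d)).prod volume) := hint
  rw [hset, Measure.volume_eq_prod, setIntegral_prod _ hint'.integrableOn]
  simp only [Measure.restrict_univ]
  have hvol : volume.real (Metric.closedBall y ε) = ε ^ d * unitBallVol d := by
    rw [measureReal_def, Measure.addHaar_closedBall _ _ hε.le, unitBallVol]
    simp [ENNReal.toReal_mul, hε.le]
  calc ∫ x in Metric.closedBall y ε, ∫ v, f₀ (x, v)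
      ≤ ∫ _ in Metric.closedBall y ε, M := by
        refine setIntegral_mono_ae hint'.integral_prod_left.integrableOn ?_ hM
        exact integrableOn_const measure_closedBall_lt_top.ne
    _ = ε ^ d * unitBallVol d * M := by
        rw [setIntegral_const, hvol, smul_eq_mul]

/-- The mass of `f₀` away from `n` excluded balls of radius `ε`. -/
lemma le_integral_indicator_exclusion (hε : 0 < ε) (hnn : ∀ z, 0 ≤ f₀ z) (hint : Integrable f₀)
    (hmass : ∫ z, f₀ z = 1) {M : ℝ} (hM : ∀ᵐ x : Rd d, (∫ v : Rd d, f₀ (x, v)) ≤ M)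
    {n : ℕ} (W : Fin n → Rd d × Rd d) :
    1 - n * (ε ^ d * unitBallVol d * M)
      ≤ ∫ z, Set.indicator {z | ∀ j, ε < dist z.1 (W j).1} f₀ z := by
  have hball : ∀ j, MeasurableSet {z : Rd d × Rd d | dist z.1 (W j).1 ≤ ε} := fun j =>
    measurableSet_le (by fun_prop) measurable_const
  have hfree : MeasurableSet {z : Rd d × Rd d | ∀ j, ε < dist z.1 (W j).1} := by
    rw [Set.ofPred_forall]
    exact MeasurableSet.iInter fun j => measurableSet_lt measurable_const (by fun_prop)
  have hsum : Integrable fun z =>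
      ∑ j, Set.indicator {z : Rd d × Rd d | dist z.1 (W j).1 ≤ ε} f₀ z :=
    integrable_finsetSum _ fun j _ => hint.indicator (hball j)
  have hind : ∀ j z, 0 ≤ Set.indicator {z : Rd d × Rd d | dist z.1 (W j).1 ≤ ε} f₀ z :=
    fun j z => Set.indicator_nonneg (fun _ _ => hnn _) z
  calc 1 - n * (ε ^ d * unitBallVol d * M)
      ≤ 1 - ∑ j, ∫ z in {z : Rd d × Rd d | dist z.1 (W j).1 ≤ ε}, f₀ z := by
        gcongr
        simpa using Finset.sum_le_card_nsmul Finset.univ _ _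
          fun j _ => setIntegral_dist_le hε hint hM (W j).1
    _ = ∫ z, (f₀ z - ∑ j, Set.indicator {z : Rd d × Rd d | dist z.1 (W j).1 ≤ ε} f₀ z) := by
        rw [integral_sub hint hsum, hmass,
          integral_finsetSum _ fun j _ => hint.indicator (hball j)]
        simp only [integral_indicator (hball _)]
    _ ≤ _ := by
        refine integral_mono (hint.sub hsum) (hint.indicator hfree) fun z => ?_
        by_cases hz : ∀ j, ε < dist z.1 (W j).1
        · rw [Set.indicator_of_mem (by exact hz)]
          exact sub_le_self _ (Finset.sum_nonneg fun j _ => hind j z)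
        · rw [Set.indicator_of_notMem (by exact hz)]
          obtain ⟨j, hj⟩ := not_forall.mp hz
          have hle := Finset.single_le_sum (fun j _ => hind j z) (Finset.mem_univ j)
          rw [Set.indicator_of_mem (by exact not_lt.mp hj)] at hle
          exact sub_nonpos.mpr hle

lemma conditionedProduct_cons (z : Rd d × Rd d) {n : ℕ} (W : Fin n → Rd d × Rd d) :
    conditionedProduct d (n + 1) ε f₀ (Fin.cons z W)
      = conditionedProduct d n ε f₀ W * Set.indicator {z | ∀ j, ε < dist z.1 (W j).1} f₀ z := by
  have hmem : (Fin.cons z W : Fin (n + 1) → Rd d × Rd d) ∈ Dset d (n + 1) ε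
      ↔ W ∈ Dset d n ε ∧ z ∈ {z : Rd d × Rd d | ∀ j, ε < dist z.1 (W j).1} := by
    simp [Dset, Fin.forall_fin_succ, and_comm]
  by_cases hW : W ∈ Dset d n ε <;>
    by_cases hz : z ∈ {z : Rd d × Rd d | ∀ j, ε < dist z.1 (W j).1} <;>
    simp only [hW, hz, and_self, and_false, false_and, iff_true, iff_false] at hmem <;>
    simp only [conditionedProduct, Set.indicator_of_mem, Set.indicator_of_notMem, hW, hz, hmem,
      not_false_eq_true, mul_zero, zero_mul]
  simp [Fin.prod_univ_succ, mul_comm]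

/-- Adding one particle costs at most the mass of the `n` excluded balls. -/
lemma partitionFunction_succ_ge (hε : 0 < ε) (hnn : ∀ z, 0 ≤ f₀ z) (hint : Integrable f₀)
    (hmass : ∫ z, f₀ z = 1) {M : ℝ} (hM : ∀ᵐ x : Rd d, (∫ v : Rd d, f₀ (x, v)) ≤ M) (n : ℕ) :
    partitionFunction d n ε f₀ * (1 - n * (ε ^ d * unitBallVol d * M))
      ≤ partitionFunction d (n + 1) ε f₀ := by
  have : SigmaFinite (volume : Measure (Fin n → Rd d × Rd d)) := Measure.pi.sigmaFinite _
  have hmp := (volume_preserving_piFinSuccAbove (fun _ : Fin (n + 1) => Rd d × Rd d) 0).symm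
  have hcons : ∀ p : (Rd d × Rd d) × (Fin n → Rd d × Rd d),
      (MeasurableEquiv.piFinSuccAbove (fun _ : Fin (n + 1) => Rd d × Rd d) 0).symm p
        = Fin.cons p.1 p.2 := fun p => by
    simp [MeasurableEquiv.piFinSuccAbove, Fin.insertNthEquiv]
  have hprod : Integrable (fun p : (Rd d × Rd d) × (Fin n → Rd d × Rd d) =>
      conditionedProduct d (n + 1) ε f₀ (Fin.cons p.1 p.2)) (volume.prod volume) := by
    have h := (hmp.integrable_comp_emb (MeasurableEquiv.measurableEmbedding _)).mpr
      (integrable_conditionedProduct (ε := ε) hint (n + 1))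
    simp only [Function.comp_def, hcons] at h
    exact h
  have hfubini : partitionFunction d (n + 1) ε f₀
      = ∫ W, ∫ z, conditionedProduct d (n + 1) ε f₀ (Fin.cons z W) := by
    rw [← integral_conditionedProduct, ← hmp.integral_comp (MeasurableEquiv.measurableEmbedding _)]
    simp only [hcons]
    exact integral_prod_symm _ hprod
  rw [hfubini, ← integral_conditionedProduct, ← integral_mul_const]
  refine integral_mono ((integrable_conditionedProduct hint n).mul_const _)
    hprod.integral_prod_right fun W => ?_
  simp only [conditionedProduct_cons, integral_const_mul]
  exact mul_le_mul_of_nonneg_left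
    (le_integral_indicator_exclusion hε hnn hint hmass hM W) (conditionedProduct_nonneg hnn W)

/-- Removing `k` of at most `N` particles, when each exclusion costs at most `κ < 1`. -/
lemma partitionFunction_add_ge (hε : 0 < ε) (hnn : ∀ z, 0 ≤ f₀ z) (hint : Integrable f₀)
    (hmass : ∫ z, f₀ z = 1) {M : ℝ} (hM₀ : 0 ≤ M)
    (hM : ∀ᵐ x : Rd d, (∫ v : Rd d, f₀ (x, v)) ≤ M) {N : ℕ}
    (hκ : N * (ε ^ d * unitBallVol d * M) < 1) (m k : ℕ) (hk : m + k ≤ N) :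
    partitionFunction d m ε f₀ * (1 - N * (ε ^ d * unitBallVol d * M)) ^ k
      ≤ partitionFunction d (m + k) ε f₀ := by
  have hc : 0 ≤ ε ^ d * unitBallVol d * M :=
    mul_nonneg (mul_nonneg (pow_nonneg hε.le d) ENNReal.toReal_nonneg) hM₀
  induction k with
  | zero => simp
  | succ k ih =>
    have hkN : ((m + k : ℕ) : ℝ) ≤ N := by exact_mod_cast (by omega : m + k ≤ N)
    calc partitionFunction d m ε f₀ * (1 - N * (ε ^ d * unitBallVol d * M)) ^ (k + 1)
        = partitionFunction d m ε f₀ * (1 - N * (ε ^ d * unitBallVol d * M)) ^ k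
            * (1 - N * (ε ^ d * unitBallVol d * M)) := by ring
      _ ≤ partitionFunction d (m + k) ε f₀ * (1 - N * (ε ^ d * unitBallVol d * M)) :=
          mul_le_mul_of_nonneg_right (ih (by omega)) (by linarith)
      _ ≤ partitionFunction d (m + k) ε f₀
            * (1 - (m + k : ℕ) * (ε ^ d * unitBallVol d * M)) := by
          have := partitionFunction_nonneg (ε := ε) hnn (m + k)
          gcongr
      _ ≤ partitionFunction d (m + (k + 1)) ε f₀ :=
          partitionFunction_succ_ge hε hnn hint hmass hM (m + k)

lemma marginal_conditionedData_le (hnn : ∀ z, 0 ≤ f₀ z) (hint : Integrable f₀)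
    {N s : ℕ} (hsN : s ≤ N) (Z : Fin s → Rd d × Rd d) :
    marginal d N s hsN (conditionedData d N ε f₀) Z
      ≤ (partitionFunction d N ε f₀)⁻¹
          * (conditionedProduct d s ε f₀ Z * partitionFunction d (N - s) ε f₀) := by
  have hinv : 0 ≤ (partitionFunction d N ε f₀)⁻¹ := inv_nonneg.mpr (partitionFunction_nonneg hnn N)
  rw [← integral_conditionedProduct d (N - s), ← integral_const_mul, ← integral_const_mul]
  refine integral_mono_of_nonneg (.of_forall fun W => ?_)
    (((integrable_conditionedProduct hint _).const_mul _).const_mul _) (.of_forall fun W => ?_)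
  · exact mul_nonneg hinv (conditionedProduct_nonneg hnn _)
  · exact mul_le_mul_of_nonneg_left (conditionedProduct_append_le hnn _ Z W) hinv

end

/-- **Upper bound on the marginals of the conditioned tensorized data (Lemma 12.3).**
In the Boltzmann–Grad scaling, if `ℓ⁻¹ |B_1^d| M ε < 1` then for every `1 ≤ s ≤ N`,
almost every `Z_s`:
`f_N^{(s)}(0,Z_s) ≤ 1_{Z_s ∈ D_s} ∏ f₀(z_i) (1 − ℓ⁻¹ |B_1^d| M ε)^{−s}`. -/
theorem conditioned_data_marginal_upper_bound
    (d N : ℕ) (hd : 2 ≤ d) (ℓ ε M : ℝ) (hℓ : 0 < ℓ) (hε : 0 < ε)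
    (hscale : (N : ℝ) * ε ^ (d - 1) = ℓ⁻¹)
    (f₀ : Rd d × Rd d → ℝ) (hmeas : Measurable f₀) (hnn : ∀ z, 0 ≤ f₀ z)
    (hint : Integrable f₀) (hmass : ∫ z, f₀ z = 1)
    (hM : ∀ᵐ x : Rd d, (∫ v : Rd d, f₀ (x, v)) ≤ M)
    (hsmall : ℓ⁻¹ * unitBallVol d * M * ε < 1)
    (s : ℕ) (hs : 1 ≤ s) (hsN : s ≤ N) :
    ∀ᵐ Z : Fin s → Rd d × Rd d,
      marginal d N s hsN (conditionedData d N ε f₀) Z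
        ≤ Set.indicator (Dset d s ε) (fun W => ∏ i, f₀ (W i)) Z *
            ((1 - ℓ⁻¹ * unitBallVol d * M * ε) ^ s)⁻¹ := by
  obtain ⟨x, hx⟩ := hM.exists
  have hM₀ : 0 ≤ M := (integral_nonneg fun v => hnn (x, v)).trans hx
  have hκ : ℓ⁻¹ * unitBallVol d * M * ε = N * (ε ^ d * unitBallVol d * M) := by
    obtain ⟨k, rfl⟩ : ∃ k, d = k + 1 := ⟨d - 1, by omega⟩
    rw [← hscale, Nat.add_sub_cancel]
    ring
  rw [hκ] at hsmall ⊢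
  refine .of_forall fun Z => (marginal_conditionedData_le hnn hint hsN Z).trans ?_
  have hpos : 0 < 1 - N * (ε ^ d * unitBallVol d * M) := sub_pos.mpr hsmall
  have hN := partitionFunction_add_ge hε hnn hint hmass hM₀ hM hsmall 0 N (by omega)
  rw [partitionFunction_zero, one_mul, zero_add] at hN
  have hNpos : 0 < partitionFunction d N ε f₀ := (pow_pos hpos N).trans_le hN
  have hratio := partitionFunction_add_ge hε hnn hint hmass hM₀ hM hsmall (N - s) s (by omega)
  rw [Nat.sub_add_cancel hsN] at hratio
  calc (partitionFunction d N ε f₀)⁻¹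
        * (conditionedProduct d s ε f₀ Z * partitionFunction d (N - s) ε f₀)
      = conditionedProduct d s ε f₀ Z
          * (partitionFunction d (N - s) ε f₀ / partitionFunction d N ε f₀) := by ring
    _ ≤ conditionedProduct d s ε f₀ Z
          * ((1 - N * (ε ^ d * unitBallVol d * M)) ^ s)⁻¹ := by
        refine mul_le_mul_of_nonneg_left ?_ (conditionedProduct_nonneg hnn Z)
        rw [div_le_iff₀ hNpos, inv_mul_eq_div, le_div_iff₀ (pow_pos hpos s)]
        exact hratio
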